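/- arXiv:0909.4956 — 10 statements merged into one kernel-verified Lean document; each statement's English description precedes it below -/
import Mathlib

section
/- With the Frenet hypotheses below, if sin θ ≠ 0 then for every s ∈ ℝ the vector T(s) + d·k(s)·A_θ(T(s)) (the derivative of the generalized offset r₀ at s) is nonzero. Hence the generalized, non-classical, offset of a unit-speed curve never has vanishing derivative at points generated by regular points of the curve: it never generates a cusp from a regular point. -/
/-- Rotation of the plane by `π/2`: `J(x,y) = (-y,x)`. -/
def Jrot (v : ℝ × ℝ) : ℝ × ℝ := (-v.2, v.1)

/-- Rotation of the plane by angle `θ`. -/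
noncomputable def rotAngle (θ : ℝ) (v : ℝ × ℝ) : ℝ × ℝ :=
  (v.1 * Real.cos θ - v.2 * Real.sin θ, v.1 * Real.sin θ + v.2 * Real.cos θ)

/-- under the Frenet hypotheses, if `sin θ ≠ 0` then the derivative
`T(s) + d·k(s)·A_θ(T(s))` of the generalized non-classical offset is nonzero for
every `s`: a regular point of the curve never generates a cusp of the offset. -/
theorem generalizedOffset_deriv_ne_zero (r T : ℝ → ℝ × ℝ) (k : ℝ → ℝ)
    (hr : ∀ s, HasDerivAt r (T s) s)
    (hT : ∀ s, (T s).1 ^ 2 + (T s).2 ^ 2 = 1)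
    (hF : ∀ s, HasDerivAt T (k s • Jrot (T s)) s)
    (d θ : ℝ) (hθ : Real.sin θ ≠ 0) (s : ℝ) :
    T s + (d * k s) • rotAngle θ (T s) ≠ 0 := by
  intro h
  have h₁ := congrArg Prod.fst h
  have h₂ := congrArg Prod.snd h
  simp only [rotAngle, Prod.fst_add, Prod.snd_add, Prod.smul_fst, Prod.smul_snd, smul_eq_mul,
    Prod.fst_zero, Prod.snd_zero] at h₁ h₂
  have h_unit := hT s
  have h_sin : d * k s * Real.sin θ = 0 := by
    linear_combination (T s).1 * h₂ - (T s).2 * h₁ - d * k s * Real.sin θ * h_unit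
  have h_coeff : d * k s = 0 := (mul_eq_zero.mp h_sin).resolve_right hθ
  rw [h_coeff, zero_mul, add_zero] at h₁ h₂
  simp [h₁, h₂] at h_unit
end

section
/- With the Frenet hypotheses below, fix s₀ ∈ ℝ and assume in addition that k has derivative k′(s₀) at s₀. Let ρ(s) = T(s) + d·k(s)·A_θ(T(s)) (the derivative of the generalized offset r₀). Then ρ is differentiable at s₀ with derivative w = k(s₀)·J(T(s₀)) + d·k′(s₀)·A_θ(T(s₀)) + d·k(s₀)²·A_θ(J(T(s₀))), and cross(ρ(s₀), w) = d·k′(s₀)·sin θ + k(s₀)·(1 + 2·d·k(s₀)·cos θ + d²·k(s₀)²), where cross((u₁,u₂),(v₁,v₂)) = u₁v₂ − u₂v₁. Consequently, a regular point of the curve generates a point of the generalized offset with vanishing signed curvature only if d·k′·sin θ + k·(k²d² + 2dk·cos θ + 1) = 0 at that point. -/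
/-- Planar cross product: `cross((u₁,u₂),(v₁,v₂)) = u₁v₂ − u₂v₁`. -/
def cross (u v : ℝ × ℝ) : ℝ := u.1 * v.2 - u.2 * v.1

/-- Rotating a differentiable planar curve by a fixed angle rotates its derivative. -/
theorem HasDerivAt.rotAngle {f : ℝ → ℝ × ℝ} {f' : ℝ × ℝ} {s : ℝ} (θ : ℝ)
    (hf : HasDerivAt f f' s) : HasDerivAt (fun x => rotAngle θ (f x)) (rotAngle θ f') s := by
  have h₁ : HasDerivAt (fun x => (f x).1) f'.1 s := hf.fst
  have h₂ : HasDerivAt (fun x => (f x).2) f'.2 s := hf.snd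
  exact ((h₁.mul_const _).sub (h₂.mul_const _)).prodMk ((h₁.mul_const _).add (h₂.mul_const _))

/-- under the Frenet hypotheses, if `k` has derivative `k′` at `s₀`,
then `ρ(s) = T(s) + d·k(s)·A_θ(T(s))` is differentiable at `s₀` with derivative
`w = k(s₀)·J(T(s₀)) + d·k′·A_θ(T(s₀)) + d·k(s₀)²·A_θ(J(T(s₀)))`, and
`cross(ρ(s₀), w) = d·k′·sin θ + k(s₀)·(1 + 2·d·k(s₀)·cos θ + d²·k(s₀)²)`. -/
theorem generalizedOffset_second_deriv_cross (r T : ℝ → ℝ × ℝ) (k : ℝ → ℝ)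
    (hr : ∀ s, HasDerivAt r (T s) s)
    (hT : ∀ s, (T s).1 ^ 2 + (T s).2 ^ 2 = 1)
    (hF : ∀ s, HasDerivAt T (k s • Jrot (T s)) s)
    (d θ : ℝ) (s₀ k' : ℝ) (hk : HasDerivAt k k' s₀) :
    HasDerivAt (fun s => T s + (d * k s) • rotAngle θ (T s))
      (k s₀ • Jrot (T s₀) + (d * k') • rotAngle θ (T s₀)
        + (d * (k s₀) ^ 2) • rotAngle θ (Jrot (T s₀))) s₀ ∧
    cross (T s₀ + (d * k s₀) • rotAngle θ (T s₀))
      (k s₀ • Jrot (T s₀) + (d * k') • rotAngle θ (T s₀)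
        + (d * (k s₀) ^ 2) • rotAngle θ (Jrot (T s₀)))
      = d * k' * Real.sin θ
        + k s₀ * (1 + 2 * d * k s₀ * Real.cos θ + d ^ 2 * (k s₀) ^ 2) := by
  constructor
  · refine ((hF s₀).add ((hk.const_mul d).smul ((hF s₀).rotAngle θ))).congr_deriv ?_
    ext <;> simp only [rotAngle, Jrot, Prod.fst_add, Prod.snd_add, Prod.smul_fst, Prod.smul_snd,
      smul_eq_mul] <;> ring
  · simp only [cross, rotAngle, Jrot, Prod.fst_add, Prod.snd_add, Prod.smul_fst, Prod.smul_snd,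
      smul_eq_mul]
    linear_combination (d * k' * Real.sin θ
        + k s₀ * (1 + 2 * d * k s₀ * Real.cos θ + d ^ 2 * (k s₀) ^ 2)) * hT s₀
      + d ^ 2 * (k s₀) ^ 3 * ((T s₀).1 ^ 2 + (T s₀).2 ^ 2) * Real.sin_sq_add_cos_sq θ
end

section
/- Fix integers p ≥ 1 and r > 2p and real numbers β, ξ. Let x(h) = h^p, y(h) = β·h^{2p} + ξ·h^r, and for h ≠ 0 let κ(h) = (x′(h)·y″(h) − x″(h)·y′(h)) / (x′(h)² + y′(h)²)^{3/2}. Then κ(h) → 2β as h → 0⁺; and if p is even (so that the place is cuspidal), κ(h) → −2β as h → 0⁻. In particular, for p even, |κ| has a removable discontinuity at h = 0 with limit 2|β|. -/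
/-- The signed curvature of the planar parametrized curve `(x(h), y(h))`,
computed by the standard formula `κ = (x′y″ − x″y′)/(x′² + y′²)^(3/2)`. -/
noncomputable def signedCurv (x y : ℝ → ℝ) (h : ℝ) : ℝ :=
  (deriv x h * deriv (deriv y) h - deriv (deriv x) h * deriv y h) /
    ((deriv x h) ^ 2 + (deriv y h) ^ 2) ^ ((3 : ℝ) / 2)

open Filter Topology

/-- The curvature of the place `(h^(n+1), β·h^(2(n+1)) + ξ·h^(2n+k+3))`, up to the sign of `h^n`. -/
noncomputable def reducedCurv (n k : ℕ) (β ξ h : ℝ) : ℝ :=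
  ((n + 1) * (β * ((2 * n + 2) * (2 * n + 1)) +
        ξ * ((2 * n + k + 3) * (2 * n + k + 2)) * h ^ (k + 1)) -
      (n + 1) * n * (β * (2 * n + 2) + ξ * (2 * n + k + 3) * h ^ (k + 1))) /
    ((n + 1) ^ 2 + (β * (2 * n + 2) * h ^ (n + 1) +
      ξ * (2 * n + k + 3) * h ^ (n + k + 2)) ^ 2) ^ ((3 : ℝ) / 2)

theorem sq_rpow_three_halves (a : ℝ) : (a ^ 2) ^ ((3 : ℝ) / 2) = |a| ^ 3 := by
  rw [← sq_abs, ← Real.rpow_natCast_mul (abs_nonneg a), ← Real.rpow_natCast]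
  norm_num

theorem tendsto_reducedCurv (n k : ℕ) (β ξ : ℝ) :
    Tendsto (reducedCurv n k β ξ) (𝓝 0) (𝓝 (2 * β)) := by
  have hn : (0 : ℝ) < n + 1 := by positivity
  have hc : ContinuousAt (reducedCurv n k β ξ) 0 := by
    unfold reducedCurv
    refine ContinuousAt.div (by fun_prop) (ContinuousAt.rpow_const (by fun_prop) ?_) ?_
    · left
      positivity
    · positivity
  have h0 : reducedCurv n k β ξ 0 = 2 * β := by
    have hB : ((n : ℝ) + 1) ^ 2 + (β * (2 * n + 2) * 0 ^ (n + 1) +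
        ξ * (2 * n + k + 3) * 0 ^ (n + k + 2)) ^ 2 = (n + 1) ^ 2 := by simp
    rw [reducedCurv, hB, sq_rpow_three_halves, abs_of_pos hn, zero_pow (Nat.succ_ne_zero k)]
    field_simp
    ring
  simpa only [ContinuousAt, h0] using hc

theorem signedCurv_place (n k : ℕ) (β ξ h : ℝ) (hh : h ≠ 0) :
    signedCurv (fun t => t ^ (n + 1))
        (fun t => β * t ^ (2 * (n + 1)) + ξ * t ^ (2 * n + k + 3)) h =
      (h ^ n) ^ 3 / |h ^ n| ^ 3 * reducedCurv n k β ξ h := by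
  have hx : deriv (fun t : ℝ => t ^ (n + 1)) = fun t => ((n : ℝ) + 1) * t ^ n := by
    funext t
    simp
  have hy : deriv (fun t : ℝ => β * t ^ (2 * (n + 1)) + ξ * t ^ (2 * n + k + 3)) =
      fun t => β * ((2 * n + 2) * t ^ (2 * n + 1)) +
        ξ * ((2 * n + k + 3) * t ^ (2 * n + k + 2)) := by
    funext t
    refine (((hasDerivAt_pow (2 * n + 2) t).const_mul β).add
      ((hasDerivAt_pow (2 * n + k + 3) t).const_mul ξ)).deriv.trans ?_
    push_cast
    rfl
  have hx2 : deriv (fun t : ℝ => ((n : ℝ) + 1) * t ^ n) h * h = (n + 1) * n * h ^ n := by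
    rw [((hasDerivAt_pow n h).const_mul ((n : ℝ) + 1)).deriv]
    cases n with
    | zero => simp
    | succ m =>
      simp only [Nat.add_sub_cancel]
      ring
  have hy2 : deriv (fun t : ℝ => β * ((2 * n + 2) * t ^ (2 * n + 1)) +
        ξ * ((2 * n + k + 3) * t ^ (2 * n + k + 2))) h =
      β * ((2 * n + 2) * ((2 * n + 1) * h ^ (2 * n))) +
        ξ * ((2 * n + k + 3) * ((2 * n + k + 2) * h ^ (2 * n + k + 1))) := by
    refine ((((hasDerivAt_pow (2 * n + 1) h).const_mul (2 * n + 2 : ℝ)).const_mul β).add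
      (((hasDerivAt_pow (2 * n + k + 2) h).const_mul
        (2 * n + k + 3 : ℝ)).const_mul ξ)).deriv.trans ?_
    push_cast
    rfl
  have hsq : (((n : ℝ) + 1) * h ^ n) ^ 2 + (β * ((2 * n + 2) * h ^ (2 * n + 1)) +
        ξ * ((2 * n + k + 3) * h ^ (2 * n + k + 2))) ^ 2 =
      (h ^ n) ^ 2 * ((n + 1) ^ 2 + (β * (2 * n + 2) * h ^ (n + 1) +
        ξ * (2 * n + k + 3) * h ^ (n + k + 2)) ^ 2) := by
    ring
  rw [signedCurv, hx, hy, hy2, hsq, Real.mul_rpow (by positivity) (by positivity),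
    sq_rpow_three_halves, reducedCurv, div_mul_div_comm]
  congr 1
  generalize deriv (fun t : ℝ => ((n : ℝ) + 1) * t ^ n) h = d at hx2
  linear_combination (-(β * (2 * n + 2) * h ^ (2 * n) +
    ξ * (2 * n + k + 3) * h ^ (2 * n + k + 1))) * hx2

/-- for the place `(h^p, β·h^{2p} + ξ·h^r)` with `p ≥ 1`, `r > 2p`,
the curvature `κ(h)` tends to `2β` as `h → 0⁺`; if `p` is even it tends to `−2β`
as `h → 0⁻`, and `|κ|` has a removable discontinuity at `0` with limit `2|β|`. -/
theorem curvature_limit_place (p r : ℕ) (hp : 1 ≤ p) (hr : 2 * p < r) (β ξ : ℝ) :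
    Filter.Tendsto (signedCurv (fun t => t ^ p) (fun t => β * t ^ (2 * p) + ξ * t ^ r))
      (nhdsWithin 0 (Set.Ioi 0)) (nhds (2 * β)) ∧
    (Even p →
      Filter.Tendsto (signedCurv (fun t => t ^ p) (fun t => β * t ^ (2 * p) + ξ * t ^ r))
        (nhdsWithin 0 (Set.Iio 0)) (nhds (-(2 * β))) ∧
      Filter.Tendsto
        (fun h => |signedCurv (fun t => t ^ p) (fun t => β * t ^ (2 * p) + ξ * t ^ r) h|)
        (nhdsWithin 0 {(0 : ℝ)}ᶜ) (nhds (2 * |β|))) := by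
  obtain ⟨n, rfl⟩ : ∃ n, p = n + 1 := ⟨p - 1, by lia⟩
  obtain ⟨k, rfl⟩ : ∃ k, r = 2 * n + k + 3 := ⟨r - (2 * n + 3), by lia⟩
  have hG := tendsto_reducedCurv n k β ξ
  refine ⟨(hG.mono_left nhdsWithin_le_nhds).congr' ?_, fun hev => ⟨?_, ?_⟩⟩
  · filter_upwards [self_mem_nhdsWithin] with h hh
    have hh : 0 < h := hh
    have hpos : 0 < h ^ n := by positivity
    rw [signedCurv_place n k β ξ h hh.ne', abs_of_pos hpos, div_self (by positivity), one_mul]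
  · have hodd : Odd n := by grind
    refine (hG.neg.mono_left nhdsWithin_le_nhds).congr' ?_
    filter_upwards [self_mem_nhdsWithin] with h hh
    have hh : h < 0 := hh
    have hneg : h ^ n < 0 := hodd.pow_neg hh
    rw [signedCurv_place n k β ξ h hh.ne, abs_of_neg hneg, Odd.neg_pow (by decide), div_neg,
      div_self (pow_ne_zero 3 hneg.ne), neg_one_mul]
  · have habs : |2 * β| = 2 * |β| := by simp [abs_mul]
    refine habs ▸ (hG.abs.mono_left nhdsWithin_le_nhds).congr' ?_
    filter_upwards [self_mem_nhdsWithin] with h hh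
    have hh : h ≠ 0 := hh
    rw [signedCurv_place n k β ξ h hh, abs_mul, abs_div, abs_pow _ 3, abs_pow |h ^ n| 3, abs_abs,
      div_self (by positivity), one_mul]
end

section
/- Fix integers p ≥ 1 and r with 2p < r < 4p, and real numbers β, ξ. Let x(h) = h^p, y(h) = β·h^{2p} + ξ·h^r, and for h ≠ 0 let κ(h) = (x′(h)·y″(h) − x″(h)·y′(h)) / (x′(h)² + y′(h)²)^{3/2}. Then (κ(h) − 2β)/h^{r−2p} → r·(r−p)·ξ/p² as h → 0⁺. -/
lemma natCast_mul_pow_pred (n : ℕ) {h : ℝ} (hh : h ≠ 0) :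
    (n : ℝ) * h ^ (n - 1) = n * h ^ n / h := by
  rcases n with _ | n
  · simp
  · simp only [Nat.add_sub_cancel]
    field_simp
    ring

lemma hasDerivAt_mul_pow_pred (n : ℕ) {h : ℝ} (hh : h ≠ 0) :
    HasDerivAt (fun t : ℝ => (n : ℝ) * t ^ (n - 1)) (n * (n - 1) * h ^ n / h ^ 2) h := by
  refine ((hasDerivAt_pow (n - 1) h).const_mul (n : ℝ)).congr_deriv ?_
  rcases n with _ | n
  · simp
  · rw [natCast_mul_pow_pred _ hh]
    simp only [Nat.add_sub_cancel]
    push_cast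
    field_simp
    ring

/-- A closed form for the curvature of the place `(h^p, β h^{2p} + ξ h^{2p+m})`. -/
lemma signedCurv_pow_place (p m : ℕ) (hp : 1 ≤ p) (β ξ : ℝ) {h : ℝ} (hh : 0 < h) :
    signedCurv (fun t => t ^ p) (fun t => β * t ^ (2 * p) + ξ * t ^ (2 * p + m)) h =
      (2 * β + (2 * p + m) * (p + m) * ξ / p ^ 2 * h ^ m) *
        (1 + (h ^ p * (2 * β + (2 * p + m) * ξ / p * h ^ m)) ^ 2) ^ (-(3 / 2) : ℝ) := by
  have h0 : h ≠ 0 := hh.ne'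
  have hp0 : (0 : ℝ) < p := by exact_mod_cast hp
  have hx : deriv (fun t : ℝ => t ^ p) = fun t => (p : ℝ) * t ^ (p - 1) := by
    ext t; exact (hasDerivAt_pow p t).deriv
  have hy : deriv (fun t : ℝ => β * t ^ (2 * p) + ξ * t ^ (2 * p + m)) = fun t =>
      β * (((2 * p : ℕ) : ℝ) * t ^ (2 * p - 1)) +
        ξ * (((2 * p + m : ℕ) : ℝ) * t ^ (2 * p + m - 1)) := by
    ext t
    exact (((hasDerivAt_pow (2 * p) t).const_mul β).add
      ((hasDerivAt_pow (2 * p + m) t).const_mul ξ)).deriv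
  have hyy := (((hasDerivAt_mul_pow_pred (2 * p) h0).const_mul β).add
    ((hasDerivAt_mul_pow_pred (2 * p + m) h0).const_mul ξ)).deriv
  unfold signedCurv
  rw [hx, hy, (hasDerivAt_mul_pow_pred p h0).deriv]
  erw [hyy]
  simp only [natCast_mul_pow_pred _ h0]
  set s : ℝ := h ^ p * (2 * β + (2 * p + m) * ξ / p * h ^ m) with hs
  have hc : 0 < (p : ℝ) * h ^ p / h := by positivity
  have hsum : ((p : ℝ) * h ^ p / h) ^ 2 +
      (β * (((2 * p : ℕ) : ℝ) * h ^ (2 * p) / h) +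
        ξ * (((2 * p + m : ℕ) : ℝ) * h ^ (2 * p + m) / h)) ^ 2 =
      ((p : ℝ) * h ^ p / h) ^ 2 * (1 + s ^ 2) := by
    rw [hs]
    push_cast
    simp only [pow_add, two_mul p]
    field_simp
  have hpos : 0 < 1 + s ^ 2 := by positivity
  have hcube : (((p : ℝ) * h ^ p / h) ^ 2) ^ ((3 : ℝ) / 2) = ((p : ℝ) * h ^ p / h) ^ 3 := by
    rw [← Real.rpow_natCast _ 2, ← Real.rpow_mul hc.le, ← Real.rpow_natCast _ 3]
    norm_num
  rw [hsum, Real.mul_rpow (by positivity) hpos.le, hcube, Real.rpow_neg hpos.le]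
  have hd : 0 < (1 + s ^ 2) ^ ((3 : ℝ) / 2) := Real.rpow_pos_of_pos hpos _
  generalize (1 + s ^ 2) ^ ((3 : ℝ) / 2) = d at hd
  push_cast
  simp only [pow_add, two_mul p]
  field_simp
  ring

/-- for the place `(h^p, β·h^{2p} + ξ·h^r)` with `p ≥ 1`, `2p < r < 4p`,
one has `(κ(h) − 2β)/h^{r−2p} → r·(r−p)·ξ/p²` as `h → 0⁺`. -/
theorem curvature_first_correction_place (p r : ℕ) (hp : 1 ≤ p)
    (hr1 : 2 * p < r) (hr2 : r < 4 * p) (β ξ : ℝ) :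
    Filter.Tendsto
      (fun h : ℝ =>
        (signedCurv (fun t => t ^ p) (fun t => β * t ^ (2 * p) + ξ * t ^ r) h - 2 * β)
          / h ^ (r - 2 * p))
      (nhdsWithin 0 (Set.Ioi 0))
      (nhds ((r : ℝ) * ((r : ℝ) - (p : ℝ)) * ξ / (p : ℝ) ^ 2)) := by
  obtain ⟨m, rfl⟩ := Nat.exists_eq_add_of_le hr1.le
  obtain ⟨k, hk⟩ := Nat.exists_eq_add_of_le (show m ≤ 2 * p by omega)
  have hk0 : k ≠ 0 := by omega
  have hp0 : p ≠ 0 := by omega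
  rw [Nat.add_sub_cancel_left]
  set F : ℝ → ℝ := fun u => (1 + u) ^ (-(3 / 2) : ℝ) with hF
  have hF0 : F 0 = 1 := by simp [hF]
  have hFd : DifferentiableAt ℝ F 0 :=
    ((differentiableAt_id.const_add 1).rpow_const (Or.inl (by simp)))
  have hDc : ContinuousAt (dslope F 0) 0 := continuousAt_dslope_same.2 hFd
  have hslope (u : ℝ) : F u = 1 + u * dslope F 0 u := by
    have := sub_smul_dslope F 0 u
    rw [hF0, sub_zero, smul_eq_mul] at this
    linarith
  set g : ℝ → ℝ := fun h => 2 * β + (2 * p + m) * ξ / p * h ^ m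
  have hu0 : (fun h : ℝ => (h ^ p * g h) ^ 2) 0 = 0 := by simp [hp0]
  have hu : ContinuousAt (fun h : ℝ => (h ^ p * g h) ^ 2) 0 := by fun_prop
  set C : ℝ := (2 * p + m) * (p + m) * ξ / p ^ 2 with hC
  have hcont : ContinuousAt (fun h : ℝ => C * F ((h ^ p * g h) ^ 2) +
      2 * β * (h ^ k * g h ^ 2 * dslope F 0 ((h ^ p * g h) ^ 2))) 0 := by
    have h1 : ContinuousAt (fun h : ℝ => F ((h ^ p * g h) ^ 2)) 0 :=
      ContinuousAt.comp_of_eq hFd.continuousAt hu hu0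
    have h2 : ContinuousAt (fun h : ℝ => dslope F 0 ((h ^ p * g h) ^ 2)) 0 :=
      ContinuousAt.comp_of_eq hDc hu hu0
    have h3 : ContinuousAt (fun h : ℝ => h ^ k * g h ^ 2) 0 := by fun_prop
    exact (h1.const_mul C).add ((h3.mul h2).const_mul (2 * β))
  have hlim := hcont.tendsto.mono_left (nhdsWithin_le_nhds (s := Set.Ioi (0 : ℝ)))
  have hval : C * F (((0 : ℝ) ^ p * g 0) ^ 2) +
      2 * β * ((0 : ℝ) ^ k * g 0 ^ 2 * dslope F 0 (((0 : ℝ) ^ p * g 0) ^ 2)) =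
      ((2 * p + m : ℕ) : ℝ) * (((2 * p + m : ℕ) : ℝ) - p) * ξ / (p : ℝ) ^ 2 := by
    simp only [zero_pow hp0, zero_pow hk0, zero_mul, zero_pow two_ne_zero, hF0, hC]
    push_cast
    ring
  rw [hval] at hlim
  refine hlim.congr' ?_
  filter_upwards [self_mem_nhdsWithin] with h hh
  have hpos : (0 : ℝ) < h := hh
  rw [signedCurv_pow_place p m hp β ξ hpos]
  change _ = ((2 * β + C * h ^ m) * F ((h ^ p * g h) ^ 2) - 2 * β) / h ^ m
  rw [eq_div_iff (by positivity)]
  have hpk : (h ^ p) ^ 2 = h ^ m * h ^ k := by rw [← pow_mul, ← pow_add, mul_comm p, hk]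
  have hs := hslope ((h ^ p * g h) ^ 2)
  linear_combination (-2 * β) * hs - 2 * β * g h ^ 2 * dslope F 0 ((h ^ p * g h) ^ 2) * hpk
end

section
/- With G = (X, Y) as defined below, as h → 0⁺ one has (X(h) − h^p + ε·d·sin θ)/h^{q−p} → −ε·d·q·β·cos θ/p. That is, the first coordinate of the generalized offset place has the expansion X(h) = −ε·d·sin θ + h^p − ε·d·(qβ cos θ/p)·h^{q−p} + ⋯. -/
/-- The speed `s(h) = √(p² + q²β²·h^{2(q−p)})` of the place `(h^p, β·h^q)` divided
by `h^{p−1}`; it is everywhere positive. -/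
noncomputable def offSpeed (p q : ℕ) (β : ℝ) (h : ℝ) : ℝ :=
  Real.sqrt ((p : ℝ) ^ 2 + (q : ℝ) ^ 2 * β ^ 2 * h ^ (2 * (q - p)))

/-- First coordinate of the generalized offset place of `(h^p, β·h^q)` at distance
`d` and angle `θ`, with sign `ε`. -/
noncomputable def offX (p q : ℕ) (β d θ ε : ℝ) (h : ℝ) : ℝ :=
  h ^ p + ε * d * (-((q : ℝ) * β * Real.cos θ) * h ^ (q - p) - (p : ℝ) * Real.sin θ)
    / offSpeed p q β h

/-- Second coordinate of the generalized offset place of `(h^p, β·h^q)` at distance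
`d` and angle `θ`, with sign `ε`. -/
noncomputable def offY (p q : ℕ) (β d θ ε : ℝ) (h : ℝ) : ℝ :=
  β * h ^ q + ε * d * (-((q : ℝ) * β * Real.sin θ) * h ^ (q - p) + (p : ℝ) * Real.cos θ)
    / offSpeed p q β h

/-- The generalized offset place `G = (X, Y)` of the place `(h^p, β·h^q)`. -/
noncomputable def offG (p q : ℕ) (β d θ ε : ℝ) (h : ℝ) : ℝ × ℝ :=
  (offX p q β d θ ε h, offY p q β d θ ε h)

theorem offSpeed_sq (p q : ℕ) (β h : ℝ) :
    offSpeed p q β h ^ 2 = (p : ℝ) ^ 2 + (q : ℝ) ^ 2 * β ^ 2 * (h ^ (q - p)) ^ 2 := by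
  rw [offSpeed, Real.sq_sqrt (by rw [pow_mul']; positivity), pow_mul']

theorem offSpeed_pos {p : ℕ} (hp : 1 ≤ p) (q : ℕ) (β h : ℝ) : 0 < offSpeed p q β h := by
  have : (0 : ℝ) < p := by exact_mod_cast hp
  rw [offSpeed, Real.sqrt_pos, pow_mul']
  positivity

theorem offSpeed_zero {p q : ℕ} (hpq : p < q) (β : ℝ) : offSpeed p q β 0 = p := by
  have : 2 * (q - p) ≠ 0 := by lia
  simp [offSpeed, zero_pow this]

theorem continuous_offSpeed (p q : ℕ) (β : ℝ) : Continuous (offSpeed p q β) := by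
  unfold offSpeed
  fun_prop

/-- The difference quotient of the first offset coordinate, with the removable singularity at
`h = 0` cancelled by rationalizing `s(h) - p`. -/
theorem offX_quotient_eq {p : ℕ} (hp : 1 ≤ p) (q : ℕ) (β d θ ε : ℝ) {h : ℝ} (hh : h ≠ 0) :
    (offX p q β d θ ε h - h ^ p + ε * d * Real.sin θ) / h ^ (q - p) =
      ε * d * (-(q * β * Real.cos θ) +
        Real.sin θ * (q ^ 2 * β ^ 2 * h ^ (q - p)) / (offSpeed p q β h + p)) /
          offSpeed p q β h := by
  have hs := offSpeed_pos hp q β h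
  have hsp : offSpeed p q β h + p ≠ 0 := by positivity
  have hu : h ^ (q - p) ≠ 0 := pow_ne_zero _ hh
  have hsq := offSpeed_sq p q β h
  rw [offX]
  generalize offSpeed p q β h = s at *
  generalize h ^ (q - p) = u at *
  field_simp
  linear_combination ε * d * Real.sin θ * hsq

/-- first-order expansion of the first offset coordinate:
`(X(h) − h^p + ε·d·sin θ)/h^{q−p} → −ε·d·q·β·cos θ/p` as `h → 0⁺`. -/
theorem offX_first_order (p q : ℕ) (hp : 1 ≤ p) (hpq : p < q)
    (β d θ ε : ℝ) (hβ : β ≠ 0) (hd : d ≠ 0) (hε : ε = 1 ∨ ε = -1) :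
    Filter.Tendsto
      (fun h : ℝ => (offX p q β d θ ε h - h ^ p + ε * d * Real.sin θ) / h ^ (q - p))
      (nhdsWithin 0 (Set.Ioi 0))
      (nhds (-(ε * d * (q : ℝ) * β * Real.cos θ / (p : ℝ)))) := by
  have hp0 : (p : ℝ) ≠ 0 := by exact_mod_cast (by lia : p ≠ 0)
  have hs : ∀ h, offSpeed p q β h ≠ 0 := fun h => (offSpeed_pos hp q β h).ne'
  have hsp : ∀ h, offSpeed p q β h + p ≠ 0 := fun h =>
    (add_pos_of_pos_of_nonneg (offSpeed_pos hp q β h) p.cast_nonneg).ne'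
  have hc := continuous_offSpeed p q β
  have hcont : Continuous fun h : ℝ => ε * d * (-(q * β * Real.cos θ) +
      Real.sin θ * (q ^ 2 * β ^ 2 * h ^ (q - p)) / (offSpeed p q β h + p)) /
        offSpeed p q β h := by
    fun_prop (disch := assumption)
  have hlim := (hcont.tendsto 0).mono_left (nhdsWithin_le_nhds (s := Set.Ioi 0))
  have hqp : q - p ≠ 0 := by lia
  convert hlim.congr' ?_ using 2
  · rw [offSpeed_zero hpq, zero_pow hqp]
    ring
  · filter_upwards [self_mem_nhdsWithin] with h hh
    exact (offX_quotient_eq hp q β d θ ε (ne_of_gt hh)).symm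
end

section
/- With G = (X, Y) as defined below, as h → 0⁺ one has (Y(h) − ε·d·cos θ)/h^{q−p} → −ε·d·q·β·sin θ/p. That is, the second coordinate of the generalized offset place has the expansion Y(h) = ε·d·cos θ − ε·d·(qβ sin θ/p)·h^{q−p} + ⋯; in particular, for sin θ ≠ 0 the order of Y(h) − Y(0) is exactly q − p. -/
/-- The difference quotient of `offY`, with the singular factor cancelled by rationalizing
`p - offSpeed p q β h`. -/
theorem offY_sub_div_pow {p q : ℕ} (hp : 1 ≤ p) (hpq : p < q) (β d θ ε : ℝ) {h : ℝ}
    (hh : h ≠ 0) :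
    (offY p q β d θ ε h - ε * d * Real.cos θ) / h ^ (q - p) =
      β * h ^ p - ε * d * (q * β * Real.sin θ) / offSpeed p q β h
        - ε * d * Real.cos θ * (q ^ 2 * β ^ 2 * h ^ (q - p))
          / (offSpeed p q β h * (p + offSpeed p q β h)) := by
  have hS := offSpeed_pos hp q β h
  have hsq := offSpeed_sq p q β h
  have hpow : h ^ q = h ^ p * h ^ (q - p) := by rw [← pow_add, Nat.add_sub_cancel' hpq.le]
  have hu : h ^ (q - p) ≠ 0 := pow_ne_zero _ hh
  rw [offY, hpow]
  generalize offSpeed p q β h = S at *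
  generalize h ^ (q - p) = u at *
  have hpS : (p : ℝ) + S ≠ 0 := by positivity
  field_simp
  linear_combination (-ε * d * Real.cos θ) * hsq

/-- first-order expansion of the second offset coordinate:
`(Y(h) − ε·d·cos θ)/h^{q−p} → −ε·d·q·β·sin θ/p` as `h → 0⁺`; in particular for
`sin θ ≠ 0` this limit is nonzero, so the order of `Y(h) − Y(0)` is exactly `q − p`. -/
theorem offY_first_order (p q : ℕ) (hp : 1 ≤ p) (hpq : p < q)
    (β d θ ε : ℝ) (hβ : β ≠ 0) (hd : d ≠ 0) (hε : ε = 1 ∨ ε = -1) :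
    Filter.Tendsto
      (fun h : ℝ => (offY p q β d θ ε h - ε * d * Real.cos θ) / h ^ (q - p))
      (nhdsWithin 0 (Set.Ioi 0))
      (nhds (-(ε * d * (q : ℝ) * β * Real.sin θ / (p : ℝ)))) ∧
    (Real.sin θ ≠ 0 → -(ε * d * (q : ℝ) * β * Real.sin θ / (p : ℝ)) ≠ 0) := by
  have hp0 : (p : ℝ) ≠ 0 := by exact_mod_cast (show p ≠ 0 by omega)
  have hq0 : (q : ℝ) ≠ 0 := by exact_mod_cast (show q ≠ 0 by omega)
  have hε0 : ε ≠ 0 := by rcases hε with rfl | rfl <;> norm_num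
  refine ⟨?_, fun hs => by simp [hp0, hq0, hε0, hβ, hd, hs]⟩
  let g : ℝ → ℝ := fun h =>
    β * h ^ p - ε * d * (q * β * Real.sin θ) / offSpeed p q β h
      - ε * d * Real.cos θ * (q ^ 2 * β ^ 2 * h ^ (q - p))
        / (offSpeed p q β h * (p + offSpeed p q β h))
  have hg : Continuous g := by
    have hc := continuous_offSpeed p q β
    have hS : ∀ h, offSpeed p q β h ≠ 0 := fun h => (offSpeed_pos hp q β h).ne'
    have hpS : ∀ h, offSpeed p q β h * (p + offSpeed p q β h) ≠ 0 := fun h => by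
      have := offSpeed_pos hp q β h
      positivity
    exact (((by fun_prop : Continuous fun h : ℝ => β * h ^ p).sub
      (continuous_const.div hc hS))).sub
        ((by fun_prop : Continuous fun h : ℝ =>
          ε * d * Real.cos θ * (q ^ 2 * β ^ 2 * h ^ (q - p))).div
            (hc.mul (continuous_const.add hc)) hpS)
  have hg0 : g 0 = -(ε * d * (q : ℝ) * β * Real.sin θ / (p : ℝ)) := by
    have hp' : p ≠ 0 := by omega
    have hn : q - p ≠ 0 := by omega
    simp only [g, offSpeed_zero hpq, zero_pow hp', zero_pow hn]
    ring
  rw [← hg0]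
  refine ((hg.tendsto 0).mono_left nhdsWithin_le_nhds).congr' ?_
  filter_upwards [self_mem_nhdsWithin] with h hh
  exact (offY_sub_div_pow hp hpq β d θ ε (ne_of_gt hh)).symm
end

section
/- With G = (X, Y) as defined below, as h → 0⁺ one has (X(h) − h^p + ε·d·sin θ + ε·d·(qβ cos θ/p)·h^{q−p}) / h^{2(q−p)} → ε·d·sin θ·q²β²/(2p²). That is, the second-order term of the first offset coordinate is ε·d·sin θ·(q²β²/(2p²))·h^{2(q−p)}. -/
/-- second-order expansion of the first offset coordinate:
`(X(h) − h^p + ε·d·sin θ + ε·d·(qβ cos θ/p)·h^{q−p})/h^{2(q−p)} → ε·d·sin θ·q²β²/(2p²)`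
as `h → 0⁺`. -/
theorem offX_second_order (p q : ℕ) (hp : 1 ≤ p) (hpq : p < q)
    (β d θ ε : ℝ) (hβ : β ≠ 0) (hd : d ≠ 0) (hε : ε = 1 ∨ ε = -1) :
    Filter.Tendsto
      (fun h : ℝ =>
        (offX p q β d θ ε h - h ^ p + ε * d * Real.sin θ
            + ε * d * ((q : ℝ) * β * Real.cos θ / (p : ℝ)) * h ^ (q - p))
          / h ^ (2 * (q - p)))
      (nhdsWithin 0 (Set.Ioi 0))
      (nhds (ε * d * Real.sin θ * (q : ℝ) ^ 2 * β ^ 2 / (2 * (p : ℝ) ^ 2))) := by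
  have hp0 : (0 : ℝ) < p := by exact_mod_cast hp
  have hn : q - p ≠ 0 := by omega
  have h2n : 2 * (q - p) ≠ 0 := by omega
  have hrad (h : ℝ) :
      0 < (p : ℝ) ^ 2 + (q : ℝ) ^ 2 * β ^ 2 * h ^ (2 * (q - p)) := by
    have : 0 ≤ h ^ (2 * (q - p)) := (even_two_mul _).pow_nonneg h
    positivity
  have hs (h : ℝ) : 0 < offSpeed p q β h := Real.sqrt_pos.2 (hrad h)
  have hs_sq (h : ℝ) : offSpeed p q β h ^ 2
      = (p : ℝ) ^ 2 + (q : ℝ) ^ 2 * β ^ 2 * h ^ (2 * (q - p)) :=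
    Real.sq_sqrt (hrad h).le
  have hs_zero : offSpeed p q β 0 = p := by
    simp [offSpeed, zero_pow h2n, Real.sqrt_sq hp0.le]
  have hs_cont : Continuous (offSpeed p q β) := by
    unfold offSpeed
    fun_prop
  let F : ℝ → ℝ := fun h =>
    ε * d * (q * β * Real.cos θ / p * h ^ (q - p) + Real.sin θ) * (q ^ 2 * β ^ 2)
      / (offSpeed p q β h * (offSpeed p q β h + p))
  have hF_cont : Continuous F := by
    refine Continuous.div (by fun_prop) (by fun_prop) fun h => ?_
    have := hs h
    positivity
  have hF_zero :
      F 0 = ε * d * Real.sin θ * (q : ℝ) ^ 2 * β ^ 2 / (2 * (p : ℝ) ^ 2) := by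
    simp only [F, hs_zero, zero_pow hn]
    ring
  rw [← hF_zero]
  refine (hF_cont.continuousAt.mono_left nhdsWithin_le_nhds).congr' ?_
  filter_upwards [self_mem_nhdsWithin] with h (hh : 0 < h)
  have hsh := hs h
  have hsq := hs_sq h
  have ht : 0 < h ^ (q - p) := pow_pos hh _
  simp only [F, offX]
  rw [mul_comm 2 (q - p), pow_mul] at hsq ⊢
  generalize offSpeed p q β h = s at *
  generalize h ^ (q - p) = t at *
  have hsp : s + p ≠ 0 := by positivity
  field_simp
  linear_combination (-(ε * d * (q * β * Real.cos θ * t + p * Real.sin θ))) * hsq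
end

section
/- With G = (X, Y) as defined below and assuming additionally p ≥ 2 (so the place P(h) = (h^p, β·h^q) is singular at h = 0), the map G is differentiable at 0, and G′(0) ≠ 0 if and only if q = p + 1; moreover, when q = p + 1, G′(0) = −(ε·d·q·β/p)·(cos θ, sin θ). In other words, a singular place of this form is smoothed by the generalized offsetting process (it generates a regular offset place) exactly when q − p = 1. -/
theorem hasDerivAt_pow_zero_of_two_le {n : ℕ} (hn : 2 ≤ n) :
    HasDerivAt (fun h : ℝ => h ^ n) 0 0 := by
  have h := hasDerivAt_pow n (0 : ℝ)
  rwa [zero_pow (by omega), mul_zero] at h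

theorem hasDerivAt_pow_zero {n : ℕ} (hn : 1 ≤ n) :
    HasDerivAt (fun h : ℝ => h ^ n) (if n = 1 then 1 else 0) 0 := by
  split_ifs with h1
  · subst h1
    simpa using hasDerivAt_id' (0 : ℝ)
  · exact hasDerivAt_pow_zero_of_two_le (by omega)

theorem hasDerivAt_offSpeed_zero {p q : ℕ} (hp : 0 < p) (hpq : p < q) (β : ℝ) :
    HasDerivAt (offSpeed p q β) 0 0 := by
  have hpow := hasDerivAt_pow_zero_of_two_le (n := 2 * (q - p)) (by omega)
  have h := ((hpow.const_mul ((q : ℝ) ^ 2 * β ^ 2)).const_add ((p : ℝ) ^ 2)).sqrt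
    (by rw [zero_pow (by omega)]; positivity)
  exact h.congr_deriv (by simp)

/-- Both coordinates of the offset place have the form `a h^m + e (b h^(q-p) + c) / s(h)`. -/
theorem hasDerivAt_offset_coordinate {p q m : ℕ} (hp : 0 < p) (hpq : p < q) (hm : 2 ≤ m)
    (β a b c e : ℝ) :
    HasDerivAt (fun h => a * h ^ m + e * (b * h ^ (q - p) + c) / offSpeed p q β h)
      (e * b / p * if q = p + 1 then 1 else 0) 0 := by
  have hp0 : (p : ℝ) ≠ 0 := by positivity
  have hs := offSpeed_zero hpq β
  have hnum := (((hasDerivAt_pow_zero (n := q - p) (by omega)).const_mul b).add_const c).const_mul e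
  have h := ((hasDerivAt_pow_zero_of_two_le hm).const_mul a).add
    (hnum.div (hasDerivAt_offSpeed_zero hp hpq β) (by rwa [hs]))
  refine h.congr_deriv ?_
  have hiff : q - p = 1 ↔ q = p + 1 := by omega
  simp only [hs, hiff]
  field_simp
  ring

theorem hasDerivAt_offG_zero {p q : ℕ} (hp : 2 ≤ p) (hpq : p < q) (β d θ ε : ℝ) :
    HasDerivAt (offG p q β d θ ε)
      ((-(ε * d * q * β / p) * if q = p + 1 then 1 else 0) • (Real.cos θ, Real.sin θ)) 0 := by
  have hX := hasDerivAt_offset_coordinate (by omega) hpq hp β 1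
    (-(q * β * Real.cos θ)) (-(p * Real.sin θ)) (ε * d)
  have hY := hasDerivAt_offset_coordinate (by omega) hpq (hp.trans hpq.le) β β
    (-(q * β * Real.sin θ)) (p * Real.cos θ) (ε * d)
  simp only [one_mul, ← sub_eq_add_neg] at hX
  refine (hX.prodMk hY).congr_deriv ?_
  rw [Prod.smul_mk, smul_eq_mul, smul_eq_mul]
  congr 1 <;> ring

/-- for `p ≥ 2` (singular place), `G` is differentiable at `0`, its
derivative is nonzero iff `q = p + 1`, and when `q = p + 1` it equals
`−(ε·d·q·β/p)·(cos θ, sin θ)`: the place is smoothed exactly when `q − p = 1`. -/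
theorem offG_smoothed_iff (p q : ℕ) (hp : 2 ≤ p) (hpq : p < q)
    (β d θ ε : ℝ) (hβ : β ≠ 0) (hd : d ≠ 0) (hε : ε = 1 ∨ ε = -1) :
    DifferentiableAt ℝ (offG p q β d θ ε) 0 ∧
    (deriv (offG p q β d θ ε) 0 ≠ 0 ↔ q = p + 1) ∧
    (q = p + 1 →
      deriv (offG p q β d θ ε) 0
        = (-(ε * d * (q : ℝ) * β / (p : ℝ))) • (Real.cos θ, Real.sin θ)) := by
  have hG := hasDerivAt_offG_zero hp hpq β d θ ε
  refine ⟨hG.differentiableAt, ?_, fun h => by rw [hG.deriv, if_pos h, mul_one]⟩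
  have hε0 : ε ≠ 0 := by rcases hε with rfl | rfl <;> norm_num
  have hp0 : (p : ℝ) ≠ 0 := by norm_cast; omega
  have hq0 : (q : ℝ) ≠ 0 := by norm_cast; omega
  have hdir : (Real.cos θ, Real.sin θ) ≠ 0 := by
    intro h
    obtain ⟨hc, hs⟩ := Prod.mk.inj h
    simpa [hc, hs] using Real.sin_sq_add_cos_sq θ
  rw [hG.deriv, smul_ne_zero_iff, and_iff_left hdir]
  split_ifs with h
  · simp only [h, iff_true]
    rw [← h]
    simp [hε0, hd, hβ, hp0, hq0]
  · simp [h]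
end

section
/- With G = (X, Y) as defined below, assume additionally sin θ ≠ 0 and q < 2p. Then the least integer n ≥ 1 with G⁽ⁿ⁾(0) ≠ 0 is n = q − p, and G^{(q−p)}(0) = (q−p)!·(−ε·d·qβ cos θ/p, −ε·d·qβ sin θ/p) ≠ 0. In particular the first entry of the signature of the offset place is q − p; since q − p and p have opposite parities exactly when q is odd, for q odd the local shape of the place (h^p, β·h^q) is not preserved by the generalized non-classical offset. -/
theorem deriv_pow_succ_smul {E : Type*} [NormedAddCommGroup E] [NormedSpace ℝ E] (k : ℕ)
    {F : ℝ → E} (hF : Differentiable ℝ F) :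
    deriv (fun h : ℝ => h ^ (k + 1) • F h) =
      fun h => h ^ k • (((k + 1 : ℕ) : ℝ) • F h + h • deriv F h) := by
  funext h
  have hd := (hasDerivAt_pow (k + 1) h).fun_smul (hF h).hasDerivAt
  rw [hd.deriv, Nat.add_sub_cancel, smul_add, smul_smul, smul_smul, pow_succ, add_comm,
    mul_comm (h ^ k) ((k + 1 : ℕ) : ℝ)]

theorem iteratedDeriv_pow_smul_zero {E : Type*} [NormedAddCommGroup E] [NormedSpace ℝ E]
    (k : ℕ) {F : ℝ → E} (hF : ContDiff ℝ (⊤ : ℕ∞) F) :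
    (∀ n < k, iteratedDeriv n (fun h : ℝ => h ^ k • F h) 0 = 0) ∧
      iteratedDeriv k (fun h : ℝ => h ^ k • F h) 0 = (k.factorial : ℝ) • F 0 := by
  induction k generalizing F with
  | zero => simp
  | succ k ih =>
    have hF' : ContDiff ℝ (⊤ : ℕ∞) (deriv F) := (contDiff_infty_iff_deriv.mp hF).2
    have hd := deriv_pow_succ_smul k (hF.differentiable (by simp))
    obtain ⟨h_lt, h_eq⟩ :=
      ih (F := fun h => ((k + 1 : ℕ) : ℝ) • F h + h • deriv F h) (by fun_prop)
    refine ⟨fun n hn => ?_, ?_⟩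
    · cases n with
      | zero => simp
      | succ n =>
        rw [iteratedDeriv_succ', hd]
        exact h_lt n (by omega)
    · rw [iteratedDeriv_succ', hd, h_eq, zero_smul, add_zero, smul_smul, Nat.factorial_succ,
        Nat.cast_mul, mul_comm]

theorem offSpeed_radicand_pos {p : ℕ} (hp : 1 ≤ p) (q : ℕ) (β h : ℝ) :
    0 < (p : ℝ) ^ 2 + (q : ℝ) ^ 2 * β ^ 2 * h ^ (2 * (q - p)) := by
  have : (0 : ℝ) < p := by exact_mod_cast hp
  rw [mul_comm 2, pow_mul]
  positivity

theorem contDiff_offSpeed {p : ℕ} (hp : 1 ≤ p) (q : ℕ) (β : ℝ) :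
    ContDiff ℝ (⊤ : ℕ∞) (offSpeed p q β) :=
  ContDiff.sqrt (by fun_prop) fun h => (offSpeed_radicand_pos hp q β h).ne'

/-- The smooth factor `T` in `p / s(h) = 1 + h^{2(q-p)} T(h)`. -/
noncomputable def offSpeedRemainder (p q : ℕ) (β : ℝ) (h : ℝ) : ℝ :=
  -((q : ℝ) ^ 2 * β ^ 2) / (offSpeed p q β h * (p + offSpeed p q β h))

theorem contDiff_offSpeedRemainder {p : ℕ} (hp : 1 ≤ p) (q : ℕ) (β : ℝ) :
    ContDiff ℝ (⊤ : ℕ∞) (offSpeedRemainder p q β) := by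
  have hs := contDiff_offSpeed hp q β
  refine ContDiff.div contDiff_const (hs.mul (contDiff_const.add hs)) fun h => ?_
  have := offSpeed_pos hp q β h
  positivity

theorem div_offSpeed {p : ℕ} (hp : 1 ≤ p) (q : ℕ) (β h : ℝ) :
    (p : ℝ) / offSpeed p q β h = 1 + h ^ (2 * (q - p)) * offSpeedRemainder p q β h := by
  have hs := offSpeed_pos hp q β h
  have hsq : offSpeed p q β h ^ 2 = _ := Real.sq_sqrt (offSpeed_radicand_pos hp q β h).le
  have hps : (p : ℝ) + offSpeed p q β h ≠ 0 := by positivity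
  unfold offSpeedRemainder
  field_simp
  linear_combination -hsq

/-- The smooth factor `F` in `G(h) = G(0) + h^{q-p} F(h)`. -/
noncomputable def offFactor (p q : ℕ) (β d θ ε : ℝ) (h : ℝ) : ℝ × ℝ :=
  (h ^ (2 * p - q) + ε * d * (-((q : ℝ) * β * Real.cos θ) / offSpeed p q β h
      - Real.sin θ * (h ^ (q - p) * offSpeedRemainder p q β h)),
    β * h ^ p + ε * d * (-((q : ℝ) * β * Real.sin θ) / offSpeed p q β h
      + Real.cos θ * (h ^ (q - p) * offSpeedRemainder p q β h)))

theorem contDiff_offFactor {p : ℕ} (hp : 1 ≤ p) (q : ℕ) (β d θ ε : ℝ) :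
    ContDiff ℝ (⊤ : ℕ∞) (offFactor p q β d θ ε) := by
  have hs := contDiff_offSpeed hp q β
  have hT := contDiff_offSpeedRemainder hp q β
  have hdiv : ∀ c : ℝ, ContDiff ℝ (⊤ : ℕ∞) fun h => c / offSpeed p q β h := fun c =>
    contDiff_const.div hs fun h => (offSpeed_pos hp q β h).ne'
  have hc := hdiv (-((q : ℝ) * β * Real.cos θ))
  have hsin := hdiv (-((q : ℝ) * β * Real.sin θ))
  unfold offFactor
  fun_prop

theorem offFactor_zero {p q : ℕ} (hp : 1 ≤ p) (hpq : p < q) (hq : q < 2 * p)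
    (β d θ ε : ℝ) :
    offFactor p q β d θ ε 0 = (-(ε * d * (q : ℝ) * β * Real.cos θ / (p : ℝ)),
      -(ε * d * (q : ℝ) * β * Real.sin θ / (p : ℝ))) := by
  have hk : q - p ≠ 0 := by omega
  have hm : 2 * p - q ≠ 0 := by omega
  have hp0 : p ≠ 0 := by omega
  simp only [offFactor, offSpeed_zero hpq, zero_pow hk, zero_pow hm, zero_pow hp0]
  ext <;> ring

theorem offG_eq_add_pow_smul {p q : ℕ} (hp : 1 ≤ p) (hpq : p < q) (hq : q < 2 * p)
    (β d θ ε : ℝ) :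
    offG p q β d θ ε = fun h => (-(ε * d * Real.sin θ), ε * d * Real.cos θ)
      + h ^ (q - p) • offFactor p q β d θ ε h := by
  funext h
  have hT := div_offSpeed hp q β h
  have hx : h ^ p = h ^ (q - p) * h ^ (2 * p - q) := by
    rw [← pow_add]; congr 1; omega
  have hy : h ^ q = h ^ (q - p) * h ^ p := by
    rw [← pow_add]; congr 1; omega
  rw [mul_comm 2 (q - p), pow_mul] at hT
  ext
  · simp only [offG, offX, offFactor, Prod.fst_add, Prod.smul_fst, smul_eq_mul]
    linear_combination hx - ε * d * Real.sin θ * hT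
  · simp only [offG, offY, offFactor, Prod.snd_add, Prod.smul_snd, smul_eq_mul]
    linear_combination β * hy + ε * d * Real.cos θ * hT

/-- for `sin θ ≠ 0` and `q < 2p`, the least `n ≥ 1` with
`G⁽ⁿ⁾(0) ≠ 0` is `n = q − p`, with
`G^{(q−p)}(0) = (q−p)!·(−εdqβ cos θ/p, −εdqβ sin θ/p) ≠ 0`; moreover `q − p` and
`p` have opposite parities exactly when `q` is odd. -/
theorem offG_first_signature_entry_q_lt_two_p (p q : ℕ) (hp : 1 ≤ p) (hpq : p < q)
    (hq : q < 2 * p) (β d θ ε : ℝ) (hβ : β ≠ 0) (hd : d ≠ 0)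
    (hθ : Real.sin θ ≠ 0) (hε : ε = 1 ∨ ε = -1) :
    (∀ n : ℕ, 1 ≤ n → n < q - p → iteratedDeriv n (offG p q β d θ ε) 0 = 0) ∧
    iteratedDeriv (q - p) (offG p q β d θ ε) 0
      = ((q - p).factorial : ℝ) •
          (-(ε * d * (q : ℝ) * β * Real.cos θ / (p : ℝ)),
           -(ε * d * (q : ℝ) * β * Real.sin θ / (p : ℝ))) ∧
    iteratedDeriv (q - p) (offG p q β d θ ε) 0 ≠ 0 ∧
    (Odd q ↔ ¬ (Even (q - p) ↔ Even p)) := by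
  obtain ⟨h_lt, h_eq⟩ := iteratedDeriv_pow_smul_zero (q - p) (contDiff_offFactor hp q β d θ ε)
  have hG : ∀ n, 1 ≤ n → iteratedDeriv n (offG p q β d θ ε) 0 =
      iteratedDeriv n (fun h : ℝ => h ^ (q - p) • offFactor p q β d θ ε h) 0 := fun n hn => by
    rw [offG_eq_add_pow_smul hp hpq hq, iteratedDeriv_const_add (by omega)]
  rw [hG (q - p) (by omega), h_eq, offFactor_zero hp hpq hq]
  refine ⟨fun n hn hnk => (hG n hn).trans (h_lt n hnk), rfl, ?_, ?_⟩
  · have hp0 : (p : ℝ) ≠ 0 := by exact_mod_cast (by omega : p ≠ 0)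
    have hq0 : (q : ℝ) ≠ 0 := by exact_mod_cast (by omega : q ≠ 0)
    have hε0 : ε ≠ 0 := by rcases hε with rfl | rfl <;> norm_num
    refine smul_ne_zero (by exact_mod_cast (q - p).factorial_ne_zero) fun h => ?_
    have h_snd := congrArg Prod.snd h
    simp [hp0, hq0, hε0, hβ, hd, hθ] at h_snd
  · rw [Nat.even_sub hpq.le, ← Nat.not_even_iff_odd]
    tauto
end

section
/- With G = (X, Y) as defined below, assume additionally sin θ ≠ 0 and q = 2p. Then the signature of G at 0 is (p, 2p) = (p, q): one has G⁽ᵖ⁾(0) = p!·(1 − 2εdβ cos θ, −2εdβ sin θ) ≠ 0, G⁽ᵐ⁾(0) = 0 for p < m < 2p, and G^{(2p)}(0) = (2p)!·(2εdβ² sin θ, β − 2εdβ² cos θ), which is linearly independent from G⁽ᵖ⁾(0) because the determinant of the pair equals β·((1 − 2εdβ cos θ)² + 4d²β² sin² θ) ≠ 0. In particular, the generalized non-classical offset preserves the local shape of every place of the form (h^p, β·h^{2p}). -/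
/-- A smooth function multiplied by `h ^ n` has vanishing derivatives of order below `n` at `0`. -/
theorem iteratedDeriv_pow_smul_zero_of_lt {E : Type*} [NormedAddCommGroup E] [NormedSpace ℝ E]
    (n : ℕ) : ∀ (m : ℕ) (k : ℝ → E), ContDiff ℝ (⊤ : ℕ∞) k → m < n →
      iteratedDeriv m (fun h : ℝ => h ^ n • k h) 0 = 0 := by
  induction n with
  | zero => intro m k _ hm; omega
  | succ n ih =>
    intro m k hk hm
    cases m with
    | zero => simp
    | succ m =>
      have hderiv : deriv (fun h : ℝ => h ^ (n + 1) • k h)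
          = fun h : ℝ => h ^ n • (((n : ℝ) + 1) • k h + h • deriv k h) := by
        funext h
        have h1 : HasDerivAt k (deriv k h) h :=
          ((hk.differentiable (by simp)) h).hasDerivAt
        have h2 := (hasDerivAt_pow (n + 1) h).smul h1
        refine h2.deriv.trans ?_
        simp only [Nat.add_sub_cancel, Nat.cast_add, Nat.cast_one]
        module
      rw [iteratedDeriv_succ', hderiv]
      refine ih m _ ?_ (by omega)
      have hk' : ContDiff ℝ (⊤ : ℕ∞) (deriv k) := (contDiff_infty_iff_deriv.1 hk).2
      fun_prop

/-- Derivatives at `0` of a vector-valued monomial. -/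
theorem iteratedDeriv_pow_smul_const_zero {E : Type*} [NormedAddCommGroup E] [NormedSpace ℝ E]
    (n : ℕ) : ∀ (m : ℕ) (a : E),
      iteratedDeriv m (fun h : ℝ => h ^ n • a) 0 = if m = n then (n.factorial : ℝ) • a else 0 := by
  induction n with
  | zero => intro m a; simp [iteratedDeriv_const]
  | succ n ih =>
    intro m a
    cases m with
    | zero => simp
    | succ m =>
      have hderiv : deriv (fun h : ℝ => h ^ (n + 1) • a)
          = fun h : ℝ => h ^ n • (((n : ℝ) + 1) • a) := by
        funext h
        refine ((hasDerivAt_pow (n + 1) h).smul_const a).deriv.trans ?_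
        simp only [Nat.add_sub_cancel, Nat.cast_add, Nat.cast_one]
        module
      rw [iteratedDeriv_succ', hderiv, ih]
      simp only [Nat.add_right_cancel_iff, Nat.factorial_succ]
      split_ifs
      · push_cast
        module
      · rfl

/-- Derivatives at `0` of a function with an expansion `c + h ^ p a + h ^ (2 p) b + o(h ^ (2 p))`
with smooth remainder. -/
theorem iteratedDeriv_expansion_zero {E : Type*} [NormedAddCommGroup E] [NormedSpace ℝ E]
    (p m : ℕ) (hm : 0 < m) (hm' : m ≤ 2 * p) (c a b : E) (k : ℝ → E)
    (hk : ContDiff ℝ (⊤ : ℕ∞) k) :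
    iteratedDeriv m (fun h : ℝ => c + (h ^ p • a + (h ^ (2 * p) • b + h ^ (2 * p + 1) • k h))) 0
      = (if m = p then (p.factorial : ℝ) • a else 0)
        + (if m = 2 * p then ((2 * p).factorial : ℝ) • b else 0) := by
  have hk' : ContDiff ℝ m k := hk.of_le (by exact_mod_cast le_top)
  rw [iteratedDeriv_const_add hm,
    iteratedDeriv_fun_add (by fun_prop) (by fun_prop),
    iteratedDeriv_fun_add (by fun_prop) (by fun_prop),
    iteratedDeriv_pow_smul_zero_of_lt (2 * p + 1) m k hk (by omega),
    iteratedDeriv_pow_smul_const_zero, iteratedDeriv_pow_smul_const_zero, add_zero]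

/-- Second-order expansion of `1 / √(1 + t)` with explicit remainder. -/
theorem one_div_sqrt_one_add_expansion (t : ℝ) (ht : 0 ≤ t) :
    1 / √(1 + t) = 1 - t / 2
      + t ^ 2 * ((√(1 + t) + 2) / (2 * √(1 + t) * (1 + √(1 + t)) ^ 2)) := by
  have hw : 0 < √(1 + t) := Real.sqrt_pos.2 (by linarith)
  have hsq : √(1 + t) ^ 2 = 1 + t := Real.sq_sqrt (by linarith)
  generalize √(1 + t) = w at hw hsq
  obtain rfl : t = w ^ 2 - 1 := by linarith
  have : 1 + w ≠ 0 := by positivity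
  field_simp
  ring

theorem offSpeed_two_mul (p : ℕ) (β h : ℝ) :
    offSpeed p (2 * p) β h = p * √(1 + 4 * β ^ 2 * h ^ (2 * p)) := by
  have : (p : ℝ) ^ 2 + ((2 * p : ℕ) : ℝ) ^ 2 * β ^ 2 * h ^ (2 * (2 * p - p))
      = (p : ℝ) ^ 2 * (1 + 4 * β ^ 2 * h ^ (2 * p)) := by
    rw [show 2 * p - p = p by omega]
    push_cast
    ring
  rw [offSpeed, this, Real.sqrt_mul (by positivity), Real.sqrt_sq (by positivity)]

/-- Expansion at `0` of the offset place of `(h ^ p, β h ^ (2 p))`. -/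
theorem exists_offG_expansion (p : ℕ) (hp : 1 ≤ p) (β d θ ε : ℝ) :
    ∃ (c : ℝ × ℝ) (k : ℝ → ℝ × ℝ), ContDiff ℝ (⊤ : ℕ∞) k ∧
      offG p (2 * p) β d θ ε = fun h : ℝ =>
        c + (h ^ p • (1 - 2 * ε * d * β * Real.cos θ, -(2 * ε * d * β * Real.sin θ))
          + (h ^ (2 * p) •
              (2 * ε * d * β ^ 2 * Real.sin θ, β - 2 * ε * d * β ^ 2 * Real.cos θ)
            + h ^ (2 * p + 1) • k h)) := by
  let w : ℝ → ℝ := fun h => √(1 + 4 * β ^ 2 * (h ^ p) ^ 2)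
  let r : ℝ → ℝ := fun h => (w h + 2) / (2 * w h * (1 + w h) ^ 2)
  have hpos : ∀ h, 0 < w h := fun h => Real.sqrt_pos.2 (by positivity)
  have hw : ContDiff ℝ (⊤ : ℕ∞) w :=
    ContDiff.sqrt (by fun_prop) fun h => by positivity
  have hr : ContDiff ℝ (⊤ : ℕ∞) r := by
    refine ContDiff.div (by fun_prop) (by fun_prop) fun h => ?_
    have := hpos h
    positivity
  refine ⟨(-(ε * d * Real.sin θ), ε * d * Real.cos θ), fun h =>
    (ε * d * h ^ (p - 1) * (4 * β ^ 3 * Real.cos θ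
        - (2 * β * Real.cos θ * h ^ p + Real.sin θ) * (16 * β ^ 4 * h ^ p * r h)),
      ε * d * h ^ (p - 1) * (4 * β ^ 3 * Real.sin θ
        + (-(2 * β * Real.sin θ * h ^ p) + Real.cos θ) * (16 * β ^ 4 * h ^ p * r h))),
    by fun_prop, ?_⟩
  funext h
  have hexp := one_div_sqrt_one_add_expansion (4 * β ^ 2 * (h ^ p) ^ 2) (by positivity)
  change 1 / w h = 1 - 4 * β ^ 2 * (h ^ p) ^ 2 / 2 + (4 * β ^ 2 * (h ^ p) ^ 2) ^ 2 * r h at hexp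
  have hp0 : (p : ℝ) ≠ 0 := by positivity
  have hw0 : w h ≠ 0 := (hpos h).ne'
  have hs : offSpeed p (2 * p) β h = p * w h := by
    rw [offSpeed_two_mul, mul_comm 2 p, pow_mul]
  have hdiv : ∀ x : ℝ, p * x / (p * w h) = x * (1 / w h) := fun x => by field_simp
  have h2 : h ^ (2 * p) = (h ^ p) ^ 2 := by rw [mul_comm, pow_mul]
  have h3 : h ^ (2 * p + 1) * h ^ (p - 1) = (h ^ p) ^ 3 := by
    rw [← pow_add, ← pow_mul]
    congr 1
    omega
  have hsub : 2 * p - p = p := by omega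
  refine Prod.ext ?_ ?_
  · simp only [offG, offX, hs, hsub, Prod.fst_add, Prod.smul_fst, smul_eq_mul, Nat.cast_mul,
      Nat.cast_ofNat]
    rw [show ε * d * (-(2 * (p : ℝ) * β * Real.cos θ) * h ^ p - p * Real.sin θ)
        = p * (ε * d * (-(2 * β * Real.cos θ) * h ^ p - Real.sin θ)) by ring, hdiv, hexp, h2]
    linear_combination (-(ε * d * (4 * β ^ 3 * Real.cos θ
        - (2 * β * Real.cos θ * h ^ p + Real.sin θ) * (16 * β ^ 4 * h ^ p * r h)))) * h3
  · simp only [offG, offY, hs, hsub, Prod.snd_add, Prod.smul_snd, smul_eq_mul, Nat.cast_mul,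
      Nat.cast_ofNat]
    rw [show ε * d * (-(2 * (p : ℝ) * β * Real.sin θ) * h ^ p + p * Real.cos θ)
        = p * (ε * d * (-(2 * β * Real.sin θ) * h ^ p + Real.cos θ)) by ring, hdiv, hexp, h2]
    linear_combination (-(ε * d * (4 * β ^ 3 * Real.sin θ
        + (-(2 * β * Real.sin θ * h ^ p) + Real.cos θ) * (16 * β ^ 4 * h ^ p * r h)))) * h3

/-- for `sin θ ≠ 0` and `q = 2p`, the signature of `G` at `0` is
`(p, 2p) = (p, q)`: `G⁽ᵖ⁾(0) = p!·(1 − 2εdβ cos θ, −2εdβ sin θ) ≠ 0`, `G⁽ᵐ⁾(0) = 0`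
for `p < m < 2p`, `G^{(2p)}(0) = (2p)!·(2εdβ² sin θ, β − 2εdβ² cos θ)`, the
determinant of the pair equals `β·((1 − 2εdβ cos θ)² + 4d²β² sin² θ) ≠ 0`, so the
two derivatives are linearly independent: the local shape of `(h^p, β·h^{2p})` is
preserved. -/
theorem offG_signature_q_eq_two_p (p q : ℕ) (hp : 1 ≤ p) (hq : q = 2 * p)
    (β d θ ε : ℝ) (hβ : β ≠ 0) (hd : d ≠ 0) (hθ : Real.sin θ ≠ 0)
    (hε : ε = 1 ∨ ε = -1) :
    iteratedDeriv p (offG p q β d θ ε) 0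
      = (p.factorial : ℝ) •
          (1 - 2 * ε * d * β * Real.cos θ, -(2 * ε * d * β * Real.sin θ)) ∧
    iteratedDeriv p (offG p q β d θ ε) 0 ≠ 0 ∧
    (∀ m : ℕ, p < m → m < 2 * p → iteratedDeriv m (offG p q β d θ ε) 0 = 0) ∧
    iteratedDeriv (2 * p) (offG p q β d θ ε) 0
      = ((2 * p).factorial : ℝ) •
          (2 * ε * d * β ^ 2 * Real.sin θ, β - 2 * ε * d * β ^ 2 * Real.cos θ) ∧
    (1 - 2 * ε * d * β * Real.cos θ) * (β - 2 * ε * d * β ^ 2 * Real.cos θ)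
        - (-(2 * ε * d * β * Real.sin θ)) * (2 * ε * d * β ^ 2 * Real.sin θ)
      = β * ((1 - 2 * ε * d * β * Real.cos θ) ^ 2
          + 4 * d ^ 2 * β ^ 2 * Real.sin θ ^ 2) ∧
    β * ((1 - 2 * ε * d * β * Real.cos θ) ^ 2
        + 4 * d ^ 2 * β ^ 2 * Real.sin θ ^ 2) ≠ 0 ∧
    LinearIndependent ℝ
      ![iteratedDeriv p (offG p q β d θ ε) 0,
        iteratedDeriv (2 * p) (offG p q β d θ ε) 0] := by
  subst hq
  have hε2 : ε ^ 2 = 1 := by rcases hε with rfl | rfl <;> norm_num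
  have hε0 : ε ≠ 0 := by rcases hε with rfl | rfl <;> norm_num
  obtain ⟨c, k, hk, hG⟩ := exists_offG_expansion p hp β d θ ε
  have hder := fun (m : ℕ) (hm : 0 < m) (hm' : m ≤ 2 * p) =>
    iteratedDeriv_expansion_zero p m hm hm' c
      (1 - 2 * ε * d * β * Real.cos θ, -(2 * ε * d * β * Real.sin θ))
      (2 * ε * d * β ^ 2 * Real.sin θ, β - 2 * ε * d * β ^ 2 * Real.cos θ) k hk
  rw [← hG] at hder
  have h1 := hder p (by omega) (by omega)
  rw [if_pos rfl, if_neg (by omega), add_zero] at h1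
  have h2 := hder (2 * p) (by omega) le_rfl
  rw [if_neg (by omega), if_pos rfl, zero_add] at h2
  have hf1 : (p.factorial : ℝ) ≠ 0 := by exact_mod_cast p.factorial_ne_zero
  have hf2 : ((2 * p).factorial : ℝ) ≠ 0 := by exact_mod_cast (2 * p).factorial_ne_zero
  have hdet : (1 - 2 * ε * d * β * Real.cos θ) * (β - 2 * ε * d * β ^ 2 * Real.cos θ)
        - (-(2 * ε * d * β * Real.sin θ)) * (2 * ε * d * β ^ 2 * Real.sin θ)
      = β * ((1 - 2 * ε * d * β * Real.cos θ) ^ 2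
          + 4 * d ^ 2 * β ^ 2 * Real.sin θ ^ 2) := by
    linear_combination 4 * d ^ 2 * β ^ 3 * Real.sin θ ^ 2 * hε2
  have hdet0 : β * ((1 - 2 * ε * d * β * Real.cos θ) ^ 2
        + 4 * d ^ 2 * β ^ 2 * Real.sin θ ^ 2) ≠ 0 := by
    refine mul_ne_zero hβ (ne_of_gt ?_)
    positivity
  have hli : LinearIndependent ℝ
      ![iteratedDeriv p (offG p (2 * p) β d θ ε) 0,
        iteratedDeriv (2 * p) (offG p (2 * p) β d θ ε) 0] := by
    rw [LinearIndependent.pair_iff]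
    intro s t hst
    rw [h1, h2, Prod.ext_iff] at hst
    simp only [Prod.fst_add, Prod.snd_add, Prod.smul_fst, Prod.smul_snd, smul_eq_mul,
      Prod.fst_zero, Prod.snd_zero] at hst
    obtain ⟨e1, e2⟩ := hst
    rw [← hdet] at hdet0
    constructor
    · refine (mul_eq_zero.1 ((mul_eq_zero.1 ?_).resolve_right hdet0)).resolve_right hf1
      linear_combination (β - 2 * ε * d * β ^ 2 * Real.cos θ) * e1
        - (2 * ε * d * β ^ 2 * Real.sin θ) * e2
    · refine (mul_eq_zero.1 ((mul_eq_zero.1 ?_).resolve_right hdet0)).resolve_right hf2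
      linear_combination (1 - 2 * ε * d * β * Real.cos θ) * e2
        + (2 * ε * d * β * Real.sin θ) * e1
  refine ⟨h1, hli.ne_zero 0, fun m hm hm' => ?_, h2, hdet, hdet0, hli⟩
  rw [hder m (by omega) hm'.le, if_neg (by omega), if_neg (by omega), add_zero]
end
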